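/- Let ρ : ℝ⁴ → ℝ be a smooth function of the variables (x,y,z,t) and set τ = e^ρ. Then the Hirota bilinear equation ((1/6)D_y D_x³ + (1/3)D_y D_t − D_x D_z) τ·τ = 0 holds identically if and only if 2ρ_xz = 2ρ_xx ρ_xy + (1/3)ρ_xxxy + (2/3)ρ_yt holds identically. -/

import Mathlib

noncomputable section

/-- Partial derivative in the `k`-th coordinate direction. -/
def pd {n : ℕ} (k : Fin n) (f : (Fin n → ℝ) → ℝ) : (Fin n → ℝ) → ℝ :=
  fun x => deriv (fun t => f (Function.update x k t)) (x k)

/-- Iterated partial derivative for a multi-index `m`. -/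
def pdM {n : ℕ} (m : Fin n → ℕ) (f : (Fin n → ℝ) → ℝ) : (Fin n → ℝ) → ℝ :=
  (List.finRange n).foldr (fun k g => (pd k)^[m k] g) f

/-- Hirota bilinear operator `D_{z₁}^{a₁} ⋯ D_{zₙ}^{aₙ} f·g`. -/
def hirota {n : ℕ} (a : Fin n → ℕ) (f g : (Fin n → ℝ) → ℝ) : (Fin n → ℝ) → ℝ :=
  fun x => ∑ i : ((k : Fin n) → Fin (a k + 1)),
    (∏ k, ((-1 : ℝ)) ^ (a k - (i k : ℕ)) * ((a k).choose (i k : ℕ)))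
      * pdM (fun k => (i k : ℕ)) f x * pdM (fun k => a k - (i k : ℕ)) g x

/-- A sum over a box of multi-indices in four variables is an iterated sum. -/
theorem sum_multiIndex_four (a : Fin 4 → ℕ) (F : ℕ → ℕ → ℕ → ℕ → ℝ) :
    ∑ i : ((k : Fin 4) → Fin (a k + 1)), F (i 0) (i 1) (i 2) (i 3)
      = ∑ i₀ ∈ Finset.range (a 0 + 1), ∑ i₁ ∈ Finset.range (a 1 + 1),
        ∑ i₂ ∈ Finset.range (a 2 + 1), ∑ i₃ ∈ Finset.range (a 3 + 1), F i₀ i₁ i₂ i₃ := by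
  simp only [Finset.sum_range]
  simp only [← Fintype.sum_prod_type']
  refine Fintype.sum_bijective (fun i : ((k : Fin 4) → Fin (a k + 1)) => (i 0, i 1, i 2, i 3)) ⟨?_, ?_⟩ _ _ fun _ => rfl
  · intro i j h
    simp only [Prod.mk.injEq] at h
    obtain ⟨h₀, h₁, h₂, h₃⟩ := h
    funext k
    fin_cases k <;> assumption
  · rintro ⟨i₀, i₁, i₂, i₃⟩
    exact ⟨Fin.cons i₀ (Fin.cons i₁ (Fin.cons i₂ (Fin.cons i₃ finZeroElim))), rfl⟩

theorem pdM_four (m : Fin 4 → ℕ) (f : (Fin 4 → ℝ) → ℝ) :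
    pdM m f = (pd 0)^[m 0] ((pd 1)^[m 1] ((pd 2)^[m 2] ((pd 3)^[m 3] f))) := rfl

theorem hirota_four (a : Fin 4 → ℕ) (f g : (Fin 4 → ℝ) → ℝ) (x : Fin 4 → ℝ) :
    hirota a f g x = ∑ i₀ ∈ Finset.range (a 0 + 1), ∑ i₁ ∈ Finset.range (a 1 + 1),
        ∑ i₂ ∈ Finset.range (a 2 + 1), ∑ i₃ ∈ Finset.range (a 3 + 1),
        ((-1 : ℝ) ^ (a 0 - i₀) * (a 0).choose i₀ * ((-1 : ℝ) ^ (a 1 - i₁) * (a 1).choose i₁)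
          * ((-1 : ℝ) ^ (a 2 - i₂) * (a 2).choose i₂) * ((-1 : ℝ) ^ (a 3 - i₃) * (a 3).choose i₃))
        * (pd 0)^[i₀] ((pd 1)^[i₁] ((pd 2)^[i₂] ((pd 3)^[i₃] f))) x
        * (pd 0)^[a 0 - i₀] ((pd 1)^[a 1 - i₁] ((pd 2)^[a 2 - i₂] ((pd 3)^[a 3 - i₃] g))) x := by
  rw [← sum_multiIndex_four]
  simp only [hirota, Fin.prod_univ_four, pdM_four]

section PartialDerivatives

variable {n : ℕ} {f g : (Fin n → ℝ) → ℝ}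

theorem hasDerivAt_comp_update (k : Fin n) {x : Fin n → ℝ} (hf : DifferentiableAt ℝ f x) :
    HasDerivAt (fun t => f (Function.update x k t)) (fderiv ℝ f x (Pi.single k 1)) (x k) := by
  have hf' : HasFDerivAt f (fderiv ℝ f x) (Function.update x k (x k)) := by
    rw [Function.update_eq_self]
    exact hf.hasFDerivAt
  exact hf'.comp_hasDerivAt (x k) (hasDerivAt_update x k (x k))

theorem pd_eq_fderiv (k : Fin n) (hf : Differentiable ℝ f) :
    pd k f = fun x => fderiv ℝ f x (Pi.single k 1) :=
  funext fun x => (hasDerivAt_comp_update k (hf x)).deriv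

theorem ContDiff.pd (k : Fin n) (hf : ContDiff ℝ (⊤ : ℕ∞) f) : ContDiff ℝ (⊤ : ℕ∞) (pd k f) := by
  rw [pd_eq_fderiv k (hf.differentiable (by simp))]
  exact (hf.fderiv_right (by simp)).clm_apply contDiff_const

theorem pd_add (k : Fin n) (hf : ContDiff ℝ (⊤ : ℕ∞) f) (hg : ContDiff ℝ (⊤ : ℕ∞) g) :
    pd k (f + g) = pd k f + pd k g := by
  have hf := hf.differentiable (by simp)
  have hg := hg.differentiable (by simp)
  funext x
  simp [pd_eq_fderiv k hf, pd_eq_fderiv k hg, pd_eq_fderiv k (hf.add hg), fderiv_add (hf x) (hg x)]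

theorem pd_mul (k : Fin n) (hf : ContDiff ℝ (⊤ : ℕ∞) f) (hg : ContDiff ℝ (⊤ : ℕ∞) g) :
    pd k (f * g) = f * pd k g + g * pd k f := by
  have hf := hf.differentiable (by simp)
  have hg := hg.differentiable (by simp)
  funext x
  simp [pd_eq_fderiv k hf, pd_eq_fderiv k hg, pd_eq_fderiv k (hf.mul hg), fderiv_mul (hf x) (hg x)]

theorem pd_exp (k : Fin n) (hf : ContDiff ℝ (⊤ : ℕ∞) f) :
    pd k (fun x => Real.exp (f x)) = pd k f * fun x => Real.exp (f x) := by
  have hf := hf.differentiable (by simp)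
  funext x
  simp [pd_eq_fderiv k hf, pd_eq_fderiv k hf.exp, fderiv_exp (hf x), mul_comm]

/-- The derivative of `u * e ^ f`, for iterating partial derivatives of an exponential. -/
theorem pd_mul_exp (k : Fin n) (hg : ContDiff ℝ (⊤ : ℕ∞) g) (hf : ContDiff ℝ (⊤ : ℕ∞) f) :
    pd k (g * fun x => Real.exp (f x)) = (pd k g + g * pd k f) * fun x => Real.exp (f x) := by
  rw [pd_mul k hg hf.exp, pd_exp k hf]
  ring

end PartialDerivatives

/-- for smooth `ρ : ℝ⁴ → ℝ` (coordinates `x = 0`, `y = 1`, `z = 2`,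
`t = 3`) and `τ = e^ρ`, the Hirota equation
`((1/6)D_y D_x³ + (1/3)D_y D_t − D_x D_z) τ·τ = 0` holds identically iff
`2ρ_xz = 2ρ_xx ρ_xy + (1/3)ρ_xxxy + (2/3)ρ_yt` holds identically. -/
theorem statement4 (ρ : (Fin 4 → ℝ) → ℝ) (hρ : ContDiff ℝ (⊤ : ℕ∞) ρ)
    (τ : (Fin 4 → ℝ) → ℝ) (hτ : τ = fun p => Real.exp (ρ p)) :
    (∀ p, (1/6) * hirota ![3, 1, 0, 0] τ τ p + (1/3) * hirota ![0, 1, 0, 1] τ τ p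
        - hirota ![1, 0, 1, 0] τ τ p = 0)
    ↔ (∀ p, 2 * pd 0 (pd 2 ρ) p
        = 2 * pd 0 (pd 0 ρ) p * pd 0 (pd 1 ρ) p
          + (1/3) * pd 0 (pd 0 (pd 0 (pd 1 ρ))) p + (2/3) * pd 1 (pd 3 ρ) p) := by
  subst hτ
  have hadd {f g : (Fin 4 → ℝ) → ℝ} (hf : ContDiff ℝ (⊤ : ℕ∞) f) (hg : ContDiff ℝ (⊤ : ℕ∞) g) :
      ContDiff ℝ (⊤ : ℕ∞) (f + g) := hf.add hg
  have hmul {f g : (Fin 4 → ℝ) → ℝ} (hf : ContDiff ℝ (⊤ : ℕ∞) f) (hg : ContDiff ℝ (⊤ : ℕ∞) g) :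
      ContDiff ℝ (⊤ : ℕ∞) (f * g) := hf.mul hg
  refine forall_congr' fun p => ?_
  simp only [hirota_four]
  simp [Finset.sum_range_succ, Nat.choose]
  simp (maxDischargeDepth := 12) only [pd_exp, pd_mul_exp, pd_add, pd_mul,
    ContDiff.pd, hadd, hmul, hρ, Pi.mul_apply, Pi.add_apply]
  have hE : Real.exp (ρ p) ^ 2 ≠ 0 := by positivity
  constructor <;> intro H
  · apply mul_left_cancel₀ hE
    linear_combination -H
  · linear_combination -Real.exp (ρ p) ^ 2 * H
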